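/- arXiv:2406.18316 — 2 statements merged into one kernel-verified Lean document; each statement's English description precedes it below -/
import Mathlib

section
/- Let 𝒢_Lie be a Lie-closed set of n-qubit Pauli strings. If P, Q ∈ 𝒢_Lie with P ≠ Q are 𝔤-connected with respect to 𝒢_Lie, then there exists R ∈ 𝒢_Lie such that R anticommutes with both P and Q. -/
open Matrix

noncomputable section

/-- The four single-qubit Pauli matrices: I, X, Y, Z. -/
def pauli1 : Fin 4 → Matrix (Fin 2) (Fin 2) ℂ :=
  ![1, !![0, 1; 1, 0], !![0, -Complex.I; Complex.I, 0], !![1, 0; 0, -1]]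

/-- The `n`-qubit Pauli string determined by `f : Fin n → Fin 4`. -/
def PauliString (n : ℕ) (f : Fin n → Fin 4) :
    Matrix (Fin n → Fin 2) (Fin n → Fin 2) ℂ :=
  fun x y => ∏ i, pauli1 (f i) (x i) (y i)

/-- Two matrices commute. -/
def MComm {n : ℕ} (A B : Matrix (Fin n → Fin 2) (Fin n → Fin 2) ℂ) : Prop :=
  A * B = B * A

/-- Two matrices anticommute. -/
def MAntiComm {n : ℕ} (A B : Matrix (Fin n → Fin 2) (Fin n → Fin 2) ℂ) : Prop :=
  A * B = -(B * A)

/-- A matrix is an `n`-qubit Pauli string. -/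
def IsPauli {n : ℕ} (A : Matrix (Fin n → Fin 2) (Fin n → Fin 2) ℂ) : Prop :=
  ∃ f : Fin n → Fin 4, A = PauliString n f

/-- A set of `n`-qubit Pauli strings is Lie-closed: whenever two of its members
anticommute, the (unique) Pauli string appearing, up to a unit scalar, in their
product also belongs to the set. -/
def LieClosed {n : ℕ} (𝒢 : Set (Matrix (Fin n → Fin 2) (Fin n → Fin 2) ℂ)) : Prop :=
  ∀ P ∈ 𝒢, ∀ Q ∈ 𝒢, MAntiComm P Q →
    ∀ (c : ℂ) (R : Matrix (Fin n → Fin 2) (Fin n → Fin 2) ℂ),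
      ‖c‖ = 1 → IsPauli R → P * Q = c • R → R ∈ 𝒢

/-- `P` and `Q` are `𝔤`-connected with respect to `𝒢`: they are distinct and
joined by a chain of anticommutations passing through elements of `𝒢`
(the empty chain meaning that `P` and `Q` themselves anticommute). -/
def GConnected {n : ℕ} (𝒢 : Set (Matrix (Fin n → Fin 2) (Fin n → Fin 2) ℂ))
    (P Q : Matrix (Fin n → Fin 2) (Fin n → Fin 2) ℂ) : Prop :=
  P ≠ Q ∧ ∃ l : List (Matrix (Fin n → Fin 2) (Fin n → Fin 2) ℂ),
    (∀ R ∈ l, R ∈ 𝒢) ∧ List.Chain' MAntiComm (P :: (l ++ [Q]))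

theorem pauli1_mul (a b : Fin 4) :
    ∃ (c : ℂ) (d : Fin 4), ‖c‖ = 1 ∧ pauli1 a * pauli1 b = c • pauli1 d := by
  have key : ∃ (c : ℂ) (d : Fin 4), (c = 1 ∨ c = Complex.I ∨ c = -Complex.I) ∧
      pauli1 a * pauli1 b = c • pauli1 d := by
    fin_cases a <;> fin_cases b
    · exact ⟨1, 0, by simp, by simp [pauli1]⟩
    · exact ⟨1, 1, by simp, by simp [pauli1]⟩
    · exact ⟨1, 2, by simp, by simp [pauli1]⟩
    · exact ⟨1, 3, by simp, by simp [pauli1]⟩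
    · exact ⟨1, 1, by simp, by simp [pauli1]⟩
    · exact ⟨1, 0, by simp, by simp [pauli1, Matrix.one_fin_two]⟩
    · exact ⟨Complex.I, 3, by simp, by simp [pauli1]⟩
    · exact ⟨-Complex.I, 2, by simp, by simp [pauli1]⟩
    · exact ⟨1, 2, by simp, by simp [pauli1]⟩
    · exact ⟨-Complex.I, 3, by simp, by simp [pauli1]⟩
    · exact ⟨1, 0, by simp, by simp [pauli1, Matrix.one_fin_two]⟩
    · exact ⟨Complex.I, 1, by simp, by simp [pauli1]⟩
    · exact ⟨1, 3, by simp, by simp [pauli1]⟩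
    · exact ⟨Complex.I, 2, by simp, by simp [pauli1]⟩
    · exact ⟨-Complex.I, 1, by simp, by simp [pauli1]⟩
    · exact ⟨1, 0, by simp, by simp [pauli1, Matrix.one_fin_two]⟩
  obtain ⟨c, d, hc, h⟩ := key
  exact ⟨c, d, by rcases hc with rfl | rfl | rfl <;> simp, h⟩

theorem pauli1_mul_comm_sign (a b : Fin 4) :
    ∃ s : ℤˣ, pauli1 a * pauli1 b = ((s : ℤ) : ℂ) • (pauli1 b * pauli1 a) := by
  fin_cases a <;> fin_cases b <;>
    first
    | (refine ⟨1, ?_⟩; simp [pauli1]; done)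
    | (refine ⟨-1, ?_⟩; simp [pauli1])

theorem PauliString_mul_apply {n : ℕ} (f g : Fin n → Fin 4) (x y : Fin n → Fin 2) :
    (PauliString n f * PauliString n g) x y =
      ∏ i, (pauli1 (f i) * pauli1 (g i)) (x i) (y i) := by
  simp only [Matrix.mul_apply, PauliString, Finset.prod_univ_sum, Fintype.piFinset_univ,
    Finset.prod_mul_distrib]

theorem IsPauli.exists_mul_eq_smul {n : ℕ} {A B : Matrix (Fin n → Fin 2) (Fin n → Fin 2) ℂ}
    (hA : IsPauli A) (hB : IsPauli B) :
    ∃ (c : ℂ) (R : Matrix (Fin n → Fin 2) (Fin n → Fin 2) ℂ),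
      ‖c‖ = 1 ∧ IsPauli R ∧ A * B = c • R := by
  obtain ⟨f, rfl⟩ := hA
  obtain ⟨g, rfl⟩ := hB
  choose c d hc h using fun i => pauli1_mul (f i) (g i)
  refine ⟨∏ i, c i, PauliString n d, by simp [hc], ⟨d, rfl⟩, ?_⟩
  ext x y
  simp [PauliString_mul_apply, h, PauliString, Finset.prod_mul_distrib]

theorem IsPauli.mComm_or_mAntiComm {n : ℕ} {A B : Matrix (Fin n → Fin 2) (Fin n → Fin 2) ℂ}
    (hA : IsPauli A) (hB : IsPauli B) : MComm A B ∨ MAntiComm A B := by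
  obtain ⟨f, rfl⟩ := hA
  obtain ⟨g, rfl⟩ := hB
  choose s hs using fun i => pauli1_mul_comm_sign (f i) (g i)
  have h : PauliString n f * PauliString n g =
      (((∏ i, s i : ℤˣ) : ℤ) : ℂ) • (PauliString n g * PauliString n f) := by
    ext x y
    simp [PauliString_mul_apply, hs, Finset.prod_mul_distrib]
  rcases Int.units_eq_one_or (∏ i, s i) with h1 | h1 <;> rw [h1] at h
  · exact Or.inl (by simpa [MComm] using h)
  · exact Or.inr (by simpa [MAntiComm] using h)

theorem MAntiComm.symm {n : ℕ} {A B : Matrix (Fin n → Fin 2) (Fin n → Fin 2) ℂ}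
    (h : MAntiComm A B) : MAntiComm B A := by
  unfold MAntiComm at *
  rw [h, neg_neg]

theorem MAntiComm.mul_left_of_mComm {n : ℕ} {A B C : Matrix (Fin n → Fin 2) (Fin n → Fin 2) ℂ}
    (hA : MAntiComm A C) (hB : MComm B C) : MAntiComm (A * B) C := by
  unfold MAntiComm MComm at *
  rw [mul_assoc, hB, ← mul_assoc, hA, neg_mul, mul_assoc]

theorem MComm.mul_left_of_mAntiComm {n : ℕ} {A B C : Matrix (Fin n → Fin 2) (Fin n → Fin 2) ℂ}
    (hA : MComm A C) (hB : MAntiComm B C) : MAntiComm (A * B) C := by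
  unfold MAntiComm MComm at *
  rw [mul_assoc, hB, mul_neg, ← mul_assoc, hA, mul_assoc]

theorem MAntiComm.of_smul_left {n : ℕ} {c : ℂ} (hc : c ≠ 0)
    {A B : Matrix (Fin n → Fin 2) (Fin n → Fin 2) ℂ} (h : MAntiComm (c • A) B) :
    MAntiComm A B := by
  unfold MAntiComm at *
  rw [smul_mul_assoc, mul_smul_comm, ← smul_neg] at h
  exact smul_right_injective _ hc h

/-- A Lie-closed set of Pauli strings contains, up to phase, the product of any two of its
anticommuting members; it anticommutes with everything that this product anticommutes with. -/
theorem LieClosed.exists_mAntiComm_of_mul {n : ℕ}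
    {𝒢 : Set (Matrix (Fin n → Fin 2) (Fin n → Fin 2) ℂ)}
    (hp : ∀ A ∈ 𝒢, IsPauli A) (hl : LieClosed 𝒢)
    {A B : Matrix (Fin n → Fin 2) (Fin n → Fin 2) ℂ} (hA : A ∈ 𝒢) (hB : B ∈ 𝒢)
    (hAB : MAntiComm A B) :
    ∃ R ∈ 𝒢, ∀ C, MAntiComm (A * B) C → MAntiComm R C := by
  obtain ⟨c, R, hc, hR, h⟩ := (hp A hA).exists_mul_eq_smul (hp B hB)
  refine ⟨R, hl A hA B hB hAB c R hc hR h, fun C hC => ?_⟩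
  exact MAntiComm.of_smul_left (norm_ne_zero_iff.mp (by simp [hc])) (h ▸ hC)

theorem LieClosed.exists_common_of_mAntiComm {n : ℕ}
    {𝒢 : Set (Matrix (Fin n → Fin 2) (Fin n → Fin 2) ℂ)}
    (hp : ∀ A ∈ 𝒢, IsPauli A) (hl : LieClosed 𝒢)
    {A B : Matrix (Fin n → Fin 2) (Fin n → Fin 2) ℂ} (hA : A ∈ 𝒢) (hB : B ∈ 𝒢)
    (hAB : MAntiComm A B) : ∃ R ∈ 𝒢, MAntiComm R A ∧ MAntiComm R B := by
  obtain ⟨R, hR, h⟩ := hl.exists_mAntiComm_of_mul hp hA hB hAB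
  exact ⟨R, hR, h _ (MComm.mul_left_of_mAntiComm rfl hAB.symm),
    h _ (hAB.mul_left_of_mComm rfl)⟩

theorem LieClosed.exists_common_of_isChain {n : ℕ}
    {𝒢 : Set (Matrix (Fin n → Fin 2) (Fin n → Fin 2) ℂ)}
    (hp : ∀ A ∈ 𝒢, IsPauli A) (hl : LieClosed 𝒢)
    {Q : Matrix (Fin n → Fin 2) (Fin n → Fin 2) ℂ} (hQ : Q ∈ 𝒢)
    (l : List (Matrix (Fin n → Fin 2) (Fin n → Fin 2) ℂ)) :
    ∀ P ∈ 𝒢, (∀ R ∈ l, R ∈ 𝒢) → List.IsChain MAntiComm (P :: (l ++ [Q])) →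
      ∃ R ∈ 𝒢, MAntiComm R P ∧ MAntiComm R Q := by
  induction l with
  | nil =>
    intro P hP _ hc
    exact hl.exists_common_of_mAntiComm hp hP hQ (by simpa using hc)
  | cons T l ih =>
    intro P hP hmem hc
    rw [List.cons_append, List.isChain_cons_cons] at hc
    have hT : T ∈ 𝒢 := hmem T (by simp)
    obtain ⟨S, hS, hST, hSQ⟩ := ih T hT (fun R hR => hmem R (by simp [hR])) hc.2
    rcases (hp S hS).mComm_or_mAntiComm (hp P hP) with hSP | hSP
    · rcases (hp T hT).mComm_or_mAntiComm (hp Q hQ) with hTQ | hTQ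
      · obtain ⟨R, hR, h⟩ := hl.exists_mAntiComm_of_mul hp hT hS hST.symm
        exact ⟨R, hR, h P (hc.1.symm.mul_left_of_mComm hSP),
          h Q (hTQ.mul_left_of_mAntiComm hSQ)⟩
      · exact ⟨T, hT, hc.1.symm, hTQ⟩
    · exact ⟨S, hS, hSP, hSQ⟩

/-- **Lemma 7.** If `P, Q ∈ 𝒢` are distinct and `𝔤`-connected
with respect to the Lie-closed set `𝒢`, then some `R ∈ 𝒢` anticommutes with
both `P` and `Q`. -/
theorem exists_common_anticommuting_element
    {n : ℕ} (hn : 1 ≤ n)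
    (𝒢 : Set (Matrix (Fin n → Fin 2) (Fin n → Fin 2) ℂ))
    (h𝒢pauli : ∀ A ∈ 𝒢, IsPauli A) (h𝒢lie : LieClosed 𝒢)
    (P Q : Matrix (Fin n → Fin 2) (Fin n → Fin 2) ℂ)
    (hP : P ∈ 𝒢) (hQ : Q ∈ 𝒢) (hne : P ≠ Q)
    (hconn : GConnected 𝒢 P Q) :
    ∃ R ∈ 𝒢, MAntiComm R P ∧ MAntiComm R Q := by
  obtain ⟨-, l, hmem, hchain⟩ := hconn
  exact h𝒢lie.exists_common_of_isChain h𝒢pauli hQ l P hP hmem hchain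
end
end

section
/- Let g : Fin s → {n-qubit Pauli strings} be pairwise commuting Pauli strings that are independent, meaning that for every nonempty subset T ⊆ Fin s the matrix product ∏_{i ∈ T} g_i is not a complex scalar multiple of the identity matrix. Then the number of functions f : Fin n → Fin 4 such that the Pauli string P f commutes with g_i for every i ∈ Fin s equals 4^n / 2^s; equivalently, 2^s times the cardinality of {f : Fin n → Fin 4 | ∀ i, (P f) * g_i = g_i * (P f)} equals 4^n. -/
open Matrix

noncomputable section

/-- The commutation sign of two single-qubit Pauli labels. -/
def pauliSign (a b : Fin 4) : ℤ :=
  if a = 0 ∨ b = 0 ∨ a = b then 1 else -1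

/-- The commutation sign of two Pauli strings. -/
def pauliStringSign {n : ℕ} (f h : Fin n → Fin 4) : ℤ :=
  ∏ j, pauliSign (f j) (h j)

theorem pauliSign_xor (a b c : Fin 4) :
    pauliSign a (b ^^^ c) = pauliSign a b * pauliSign a c := by
  revert a b c; decide

theorem sum_pauliSign {b : Fin 4} (hb : b ≠ 0) : ∑ a, pauliSign a b = 0 := by
  revert b; decide

theorem pauli1_mul_comm (a b : Fin 4) :
    pauli1 a * pauli1 b = (pauliSign a b : ℂ) • (pauli1 b * pauli1 a) := by
  fin_cases a <;> fin_cases b <;> ext i j <;> fin_cases i <;> fin_cases j <;>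
    simp [pauli1, pauliSign, Matrix.mul_apply]

theorem pauli1_mul_self (a : Fin 4) : pauli1 a * pauli1 a = 1 := by
  fin_cases a <;> ext i j <;> fin_cases i <;> fin_cases j <;>
    simp [pauli1, Matrix.mul_apply]

theorem exists_pauli1_mul (a b : Fin 4) :
    ∃ c : ℂ, pauli1 a * pauli1 b = c • pauli1 (a ^^^ b) := by
  have key : ∃ c ∈ ({1, Complex.I, -Complex.I} : Set ℂ),
      pauli1 a * pauli1 b = c • pauli1 (a ^^^ b) := by
    simp only [Set.mem_insert_iff, Set.mem_singleton_iff, exists_eq_or_imp, exists_eq_left]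
    fin_cases a <;> fin_cases b <;>
      simp [pauli1, ← Matrix.ext_iff, Fin.forall_fin_two]
  exact key.imp fun _ h => h.2

theorem pauliString_mul_apply {n : ℕ} (f h : Fin n → Fin 4) (x y : Fin n → Fin 2) :
    (PauliString n f * PauliString n h) x y =
      ∏ i, (pauli1 (f i) * pauli1 (h i)) (x i) (y i) := by
  simp only [Matrix.mul_apply, PauliString, ← Finset.prod_mul_distrib, Finset.prod_univ_sum,
    Fintype.piFinset_univ]

theorem pauliString_zero (n : ℕ) : PauliString n 0 = 1 := by
  ext x y
  simp only [PauliString, Pi.zero_apply, pauli1, Matrix.cons_val_zero, Matrix.one_apply,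
    Finset.prod_ite_zero, Finset.prod_const_one, Finset.mem_univ, true_imp_iff, funext_iff]

theorem pauliString_mul_self {n : ℕ} (f : Fin n → Fin 4) :
    PauliString n f * PauliString n f = 1 := by
  ext x y
  simp only [pauliString_mul_apply, pauli1_mul_self, Matrix.one_apply,
    Finset.prod_ite_zero, Finset.prod_const_one, Finset.mem_univ, true_imp_iff, funext_iff]

theorem pauliString_mul_comm {n : ℕ} (f h : Fin n → Fin 4) :
    PauliString n f * PauliString n h =
      (pauliStringSign f h : ℂ) • (PauliString n h * PauliString n f) := by
  ext x y
  simp only [Matrix.smul_apply, pauliString_mul_apply, pauliStringSign, Int.cast_prod,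
    smul_eq_mul, ← Finset.prod_mul_distrib]
  refine Finset.prod_congr rfl fun i _ => ?_
  rw [pauli1_mul_comm, Matrix.smul_apply, smul_eq_mul]

theorem exists_pauliString_mul {n : ℕ} (f h : Fin n → Fin 4) :
    ∃ c : ℂ, PauliString n f * PauliString n h = c • PauliString n (fun i => f i ^^^ h i) := by
  choose c hc using fun i => exists_pauli1_mul (f i) (h i)
  refine ⟨∏ i, c i, ?_⟩
  ext x y
  simp only [Matrix.smul_apply, pauliString_mul_apply, PauliString, hc, smul_eq_mul,
    Finset.prod_mul_distrib]

theorem pauliStringSign_xor {n : ℕ} (f h k : Fin n → Fin 4) :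
    pauliStringSign f (fun i => h i ^^^ k i) = pauliStringSign f h * pauliStringSign f k := by
  simp only [pauliStringSign, pauliSign_xor, Finset.prod_mul_distrib]

theorem pauliStringSign_eq_one_or {n : ℕ} (f h : Fin n → Fin 4) :
    pauliStringSign f h = 1 ∨ pauliStringSign f h = -1 := by
  refine Finset.prod_induction _ (fun z : ℤ => z = 1 ∨ z = -1) ?_ (Or.inl rfl) fun i _ => ?_
  · rintro a b (rfl | rfl) (rfl | rfl) <;> simp
  · unfold pauliSign
    split_ifs <;> simp

theorem sum_pauliStringSign {n : ℕ} {h : Fin n → Fin 4} (hh : h ≠ 0) :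
    ∑ f, pauliStringSign f h = 0 := by
  obtain ⟨j, hj⟩ := Function.ne_iff.mp hh
  have key := Finset.prod_univ_sum (fun _ : Fin n => (Finset.univ : Finset (Fin 4)))
    (fun i a => pauliSign a (h i))
  rw [Fintype.piFinset_univ] at key
  exact key.symm.trans (Finset.prod_eq_zero (Finset.mem_univ j) (sum_pauliSign hj))

theorem mComm_pauliString_iff {n : ℕ} (f h : Fin n → Fin 4) :
    MComm (PauliString n f) (PauliString n h) ↔ pauliStringSign f h = 1 := by
  have hc := pauliString_mul_comm f h
  refine ⟨fun hm => (pauliStringSign_eq_one_or f h).resolve_right fun hs => ?_, fun hs => ?_⟩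
  · rw [hs, ← show _ = _ from hm] at hc
    have h0 : PauliString n f * PauliString n h = 0 := by
      rw [Int.cast_neg, Int.cast_one, neg_one_smul] at hc
      ext x y
      exact self_eq_neg.mp (congrFun₂ hc x y)
    have h1 : PauliString n f * (PauliString n f * PauliString n h) * PauliString n h = 1 := by
      rw [← mul_assoc, pauliString_mul_self, one_mul, pauliString_mul_self]
    rw [h0, mul_zero, zero_mul] at h1
    exact zero_ne_one h1
  · simpa [MComm, hs] using hc

theorem exists_noncommProd_eq_smul_pauliString {n : ℕ} {ι : Type*}
    (l : ι → Fin n → Fin 4) (T : Finset ι)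
    (hcomm : (T : Set ι).Pairwise (Function.onFun Commute fun i => PauliString n (l i))) :
    ∃ (c : ℂ) (h : Fin n → Fin 4),
      T.noncommProd (fun i => PauliString n (l i)) hcomm = c • PauliString n h ∧
        ∀ f, pauliStringSign f h = ∏ i ∈ T, pauliStringSign f (l i) := by
  classical
  induction T using Finset.induction_on with
  | empty =>
    exact ⟨1, 0, by simp [pauliString_zero], fun f => by simp [pauliStringSign, pauliSign]⟩
  | insert a T ha ih =>
    obtain ⟨c, h, hT, hsign⟩ := ih (hcomm.mono (by simp))
    obtain ⟨d, hd⟩ := exists_pauliString_mul (l a) h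
    refine ⟨c * d, fun i => l a i ^^^ h i, ?_, fun f => ?_⟩
    · rw [Finset.noncommProd_insert_of_notMem _ _ _ _ ha, hT, mul_smul_comm, hd, smul_smul]
    · rw [pauliStringSign_xor, hsign, Finset.prod_insert ha]

/-- If every nonempty product of the `±1`-valued functions `ε · i` sums to zero, then each
condition `ε a i = 1` halves the number of solutions. -/
theorem two_pow_mul_card_eq_card {α ι : Type*} [Fintype α] [Fintype ι] (ε : α → ι → ℤ)
    (hε : ∀ a i, ε a i = 1 ∨ ε a i = -1)
    (hsum : ∀ T : Finset ι, T.Nonempty → ∑ a, ∏ i ∈ T, ε a i = 0) :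
    2 ^ Fintype.card ι * Nat.card {a // ∀ i, ε a i = 1} = Fintype.card α := by
  classical
  have hprod (a : α) :
      ∏ i, (1 + ε a i) = if ∀ i, ε a i = 1 then 2 ^ Fintype.card ι else 0 := by
    split_ifs with h
    · simp [h, Finset.card_univ]
    · obtain ⟨i, hi⟩ := not_forall.mp h
      exact Finset.prod_eq_zero (Finset.mem_univ i) (by simp [(hε a i).resolve_left hi])
  have hexp : ∑ a, ∏ i, (1 + ε a i) = Fintype.card α := by
    simp_rw [Finset.prod_one_add]
    rw [Finset.sum_comm, Finset.sum_eq_single ∅]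
    · simp
    · exact fun T _ hT => hsum T (Finset.nonempty_iff_ne_empty.mpr hT)
    · simp
  simp_rw [hprod, ← Finset.sum_filter, Finset.sum_const, nsmul_eq_mul] at hexp
  rw [Nat.card_eq_fintype_card, Fintype.card_subtype, mul_comm]
  exact_mod_cast hexp

/-- **Lemma 11, equality part.** If `g : Fin s → _` are pairwise
commuting, independent Pauli strings (no nonempty subproduct is a scalar multiple
of the identity), then the number of Pauli labels `f` whose Pauli string commutes
with every `g i` satisfies `2^s * #{f | ∀ i, P f commutes with g i} = 4^n`. -/
theorem card_centralizer_of_independent_stabilizers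
    {n s : ℕ} (hn : 1 ≤ n)
    (g : Fin s → Matrix (Fin n → Fin 2) (Fin n → Fin 2) ℂ)
    (hpauli : ∀ i, IsPauli (g i))
    (hcomm : ∀ i j, Commute (g i) (g j))
    (hindep : ∀ T : Finset (Fin s), T.Nonempty → ∀ c : ℂ,
      T.noncommProd g (fun i _ j _ _ => hcomm i j) ≠
        c • (1 : Matrix (Fin n → Fin 2) (Fin n → Fin 2) ℂ)) :
    2 ^ s * Nat.card {f : Fin n → Fin 4 // ∀ i, MComm (PauliString n f) (g i)} = 4 ^ n := by
  choose l hl using hpauli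
  obtain rfl : g = fun i => PauliString n (l i) := funext hl
  have key := two_pow_mul_card_eq_card (fun f i => pauliStringSign f (l i))
    (fun f i => pauliStringSign_eq_one_or f (l i)) fun T hT => by
      obtain ⟨c, h, hprod, hsign⟩ :=
        exists_noncommProd_eq_smul_pauliString l T fun i _ j _ _ => hcomm i j
      simp_rw [← hsign]
      refine sum_pauliStringSign fun h0 => hindep T hT c ?_
      rw [hprod, h0, pauliString_zero]
  simpa [mComm_pauliString_iff] using key
end
end
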